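/- arXiv:2505.04039 — 2 statements merged into one kernel-verified Lean document; each statement's English description precedes it below -/
import Mathlib

section
/- Let 1 ≤ l ≤ s and let ζ ∈ ℂ be a primitive p^l-th root of unity. Then there exists a single polynomial F ∈ ℂ[z] such that both T_{s+1}(z, ζ) = T_l(z, ζ) · F(z^{p^l}) and T_s(z^p, ζ^p) = T_{l−1}(z^p, ζ^p) · F(z^{p^l}) hold in ℂ[z] (the cofactors F₁ and G₁ arising from the two coefficient expansions coincide). -/
open MvPolynomial Finset

/-- Dimension vector of the framed `A_{n-1}` quiver: `v i = min(i, k, n - i)`. -/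
def dimv (k n i : ℕ) : ℕ := min i (min k (n - i))

/-- `c_s = (p^s - 1)·ω` where `ω = r₀/q₀` (an integer under the standing hypotheses). -/
def cExp (p r₀ q₀ s : ℕ) : ℕ := (p ^ s - 1) * r₀ / q₀

/-- `a_s = (p^s - 1)·(1 - ω)`. -/
def aExp (p r₀ q₀ s : ℕ) : ℕ := (p ^ s - 1) - cExp p r₀ q₀ s

/-- `b_s = (p^s - 1)·(1 - 2ω)/2`. -/
def bExp (p r₀ q₀ s : ℕ) : ℕ := (p ^ s - 1 - 2 * cExp p r₀ q₀ s) / 2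

/-- The coefficient ring `ℤ[z,q]`, with `z = X false` and `q = X true`. -/
abbrev Zq : Type := MvPolynomial Bool ℤ

noncomputable def Zvar : Zq := MvPolynomial.X false
noncomputable def Qvar : Zq := MvPolynomial.X true

/-- The superpotential factor `Φ̄_s(x, z, q)`, a polynomial in the variables
`x_{i,j}` (indexed by pairs `(i,j) : ℕ × ℕ`) with coefficients in `ℤ[z,q]`. -/
noncomputable def Phibar (p r₀ q₀ k n s : ℕ) : MvPolynomial (ℕ × ℕ) Zq :=
  (∏ m ∈ Icc 1 (n - 1), ∏ j ∈ Icc 1 (dimv k n m), X (m, j)) ^ aExp p r₀ q₀ s *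
  (∏ m ∈ Icc 1 (n - 1),
    ∏ ij ∈ ((Icc 1 (dimv k n m)) ×ˢ (Icc 1 (dimv k n m))).filter (fun ij => ij.1 ≠ ij.2),
      ∏ r ∈ range (bExp p r₀ q₀ s), (X (m, ij.1) - C (Qvar ^ r) * X (m, ij.2))) *
  (∏ i ∈ Icc 1 (n - 2), ∏ a ∈ Icc 1 (dimv k n i), ∏ b ∈ Icc 1 (dimv k n (i + 1)),
      ∏ r ∈ range (cExp p r₀ q₀ s), (X (i, a) - C (Qvar ^ r) * X (i + 1, b))) *
  (∏ i ∈ Icc 1 k, ∏ r ∈ range (cExp p r₀ q₀ s),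
      (C Zvar - C (Qvar ^ r) * X (k, i)) * (1 - C (Qvar ^ r) * X (n - k, i)))

/-- The Vandermonde factor `Δ(x)`. -/
noncomputable def Vand (k n : ℕ) : MvPolynomial (ℕ × ℕ) Zq :=
  ∏ m ∈ Icc 1 (n - 1),
    ∏ ij ∈ ((Icc 1 (dimv k n m)) ×ˢ (Icc 1 (dimv k n m))).filter (fun ij => ij.1 < ij.2),
      (X (m, ij.2) - X (m, ij.1))

/-- `Φ_s = Δ · Φ̄_s`. -/
noncomputable def Phi (p r₀ q₀ k n s : ℕ) : MvPolynomial (ℕ × ℕ) Zq :=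
  Vand k n * Phibar p r₀ q₀ k n s

/-- Exponent vector of the monomial `∏_{i,j} x_{i,j}^{j·p^s - 1}`. -/
noncomputable def expVec (p k n s : ℕ) : (ℕ × ℕ) →₀ ℕ :=
  ∑ i ∈ Icc 1 (n - 1), ∑ j ∈ Icc 1 (dimv k n i), Finsupp.single (i, j) (j * p ^ s - 1)

/-- The truncation `T_s(z,q) ∈ ℤ[z,q]` of the K-theoretic vertex function of
`T*Gr(k,n)`: the coefficient of `∏ x_{i,j}^{j·p^s - 1}` in `Φ_s(x,z,q)`. -/
noncomputable def Ts (p r₀ q₀ k n s : ℕ) : Zq :=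
  MvPolynomial.coeff (expVec p k n s) (Phi p r₀ q₀ k n s)

/-- Evaluation `ℤ[z,q] → ℂ[z]` sending `q ↦ ζ` and `z ↦ z^e`. -/
noncomputable def evalQ (ζ : ℂ) (e : ℕ) : Zq →+* Polynomial ℂ :=
  MvPolynomial.eval₂Hom (Int.castRingHom (Polynomial ℂ))
    (fun b => bif b then Polynomial.C ζ else Polynomial.X ^ e)

section Superpotential

variable {R : Type*} [CommRing R]

/-- The product of all the variables `x_{i,j}`. -/
noncomputable def boxProd (R : Type*) [CommRing R] (k n : ℕ) : MvPolynomial (ℕ × ℕ) R :=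
  ∏ m ∈ Icc 1 (n - 1), ∏ j ∈ Icc 1 (dimv k n m), X (m, j)

/-- The product of Vandermonde factors over an arbitrary coefficient ring. -/
noncomputable def vandProd (R : Type*) [CommRing R] (k n : ℕ) : MvPolynomial (ℕ × ℕ) R :=
  ∏ m ∈ Icc 1 (n - 1),
    ∏ ij ∈ ((Icc 1 (dimv k n m)) ×ˢ (Icc 1 (dimv k n m))).filter (fun ij => ij.1 < ij.2),
      (X (m, ij.2) - X (m, ij.1))

/-- The superpotential with free exponents `a`, `b`, `c` and parameters `z`, `q` in an arbitrary
coefficient ring. -/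
noncomputable def superpotential (z q : R) (k n a b c : ℕ) : MvPolynomial (ℕ × ℕ) R :=
  boxProd R k n ^ a *
  (∏ m ∈ Icc 1 (n - 1),
    ∏ ij ∈ ((Icc 1 (dimv k n m)) ×ˢ (Icc 1 (dimv k n m))).filter (fun ij => ij.1 ≠ ij.2),
      ∏ r ∈ range b, (X (m, ij.1) - C (q ^ r) * X (m, ij.2))) *
  (∏ i ∈ Icc 1 (n - 2), ∏ a ∈ Icc 1 (dimv k n i), ∏ b ∈ Icc 1 (dimv k n (i + 1)),
      ∏ r ∈ range c, (X (i, a) - C (q ^ r) * X (i + 1, b))) *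
  (∏ i ∈ Icc 1 k, ∏ r ∈ range c,
      (C z - C (q ^ r) * X (k, i)) * (1 - C (q ^ r) * X (n - k, i)))

lemma map_Phi (f : Zq →+* R) (p r₀ q₀ k n s : ℕ) :
    map f (Phi p r₀ q₀ k n s) = vandProd R k n *
      superpotential (f Zvar) (f Qvar) k n (aExp p r₀ q₀ s) (bExp p r₀ q₀ s)
        (cExp p r₀ q₀ s) := by
  simp only [Phi, Vand, Phibar, vandProd, superpotential, boxProd, map_mul, map_prod, map_pow,
    map_sub, map_one, map_X, map_C]

lemma superpotential_zero (z q : R) (k n : ℕ) : superpotential z q k n 0 0 0 = 1 := by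
  simp [superpotential]

lemma prod_range_sub_root_pow_mul [IsDomain R] {N : ℕ} (hN : 0 < N) {ζ : R}
    (hζ : IsPrimitiveRoot ζ N) (x y : R) :
    ∏ r ∈ range N, (x - ζ ^ r * y) = x ^ N - y ^ N := by
  classical
  rw [hζ.pow_sub_pow_eq_prod_sub_mul x y hN]
  symm
  have himg : Polynomial.nthRootsFinset N (1 : R) = (range N).image (ζ ^ ·) := by
    symm
    apply Finset.eq_of_subset_of_card_le
    · intro x hx
      obtain ⟨i, -, rfl⟩ := Finset.mem_image.1 hx
      rw [Polynomial.mem_nthRootsFinset hN, ← pow_mul, mul_comm, pow_mul, hζ.pow_eq_one, one_pow]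
    · rw [hζ.card_nthRootsFinset, Finset.card_image_of_injOn, Finset.card_range]
      simpa using hζ.injOn_pow
  rw [himg, Finset.prod_image]
  simpa using hζ.injOn_pow

lemma prod_range_add_mul_sub_root_pow_mul [IsDomain R] {N : ℕ} (hN : 0 < N) {ζ : R}
    (hζ : IsPrimitiveRoot ζ N) (x y : R) (c t : ℕ) :
    ∏ r ∈ range (c + N * t), (x - ζ ^ r * y) =
      (∏ r ∈ range c, (x - ζ ^ r * y)) * (x ^ N - y ^ N) ^ t := by
  have key (u : ℕ) : ∏ r ∈ range (N * u), (x - ζ ^ r * y) = (x ^ N - y ^ N) ^ u := by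
    induction u with
    | zero => simp
    | succ u ih =>
      rw [mul_add, mul_one, Finset.prod_range_add, ih, pow_succ,
        ← prod_range_sub_root_pow_mul hN hζ]
      congr 1
      refine Finset.prod_congr rfl fun r _ => ?_
      rw [pow_add, pow_mul, hζ.pow_eq_one, one_pow, one_mul]
  rw [add_comm, Finset.prod_range_add, key, mul_comm]
  congr 1
  refine Finset.prod_congr rfl fun r _ => ?_
  rw [pow_add, pow_mul, hζ.pow_eq_one, one_pow, one_mul]

lemma superpotential_factor [IsDomain R] {N : ℕ} (hN : 0 < N) {ζ : R}
    (hζ : IsPrimitiveRoot ζ N) (z : R) (k n a b c a' b' c' : ℕ) :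
    superpotential z ζ k n (a + N * a') (b + N * b') (c + N * c') =
      superpotential z ζ k n a b c * expand N (superpotential (z ^ N) 1 k n a' b' c') := by
  have hζ' : IsPrimitiveRoot (C ζ : MvPolynomial (ℕ × ℕ) R) N :=
    hζ.map_of_injective (C_injective _ _)
  simp only [superpotential, boxProd, map_mul, map_prod, map_pow, map_sub, map_one, expand_X,
    expand_C, Finset.prod_mul_distrib, prod_range_add_mul_sub_root_pow_mul hN hζ', one_pow,
    one_mul, Finset.prod_const, Finset.card_range, pow_add, pow_mul, ← Finset.prod_pow]
  ring

lemma coeff_smul_mul_expand {σ : Type*} [DecidableEq σ] {N : ℕ} (hN : N ≠ 0)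
    (P Q : MvPolynomial σ R) (e : σ →₀ ℕ) :
    coeff (N • e) (P * expand N Q) =
      ∑ d ∈ HasAntidiagonal.antidiagonal e, coeff (N • d.1) P * coeff d.2 Q := by
  rw [coeff_mul]
  symm
  apply Finset.sum_of_injOn (fun d : (σ →₀ ℕ) × (σ →₀ ℕ) => (N • d.1, N • d.2))
  · rintro ⟨a, b⟩ - ⟨a', b'⟩ - h
    simp only [Prod.mk.injEq] at h
    have inj {u v : σ →₀ ℕ} (h : N • u = N • v) : u = v := by
      ext x
      have := DFunLike.congr_fun h x
      simpa [hN] using this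
    rw [inj h.1, inj h.2]
  · rintro ⟨a, b⟩ h
    simp only [mem_coe, HasAntidiagonal.mem_antidiagonal] at h ⊢
    simp [← smul_add, h]
  · rintro ⟨a, b⟩ h hnot
    simp only [HasAntidiagonal.mem_antidiagonal] at h
    by_cases hb : ∀ i, N ∣ b i
    · have ha : ∀ i, N ∣ a i := fun i => by
        have := DFunLike.congr_fun h i
        simp only [Finsupp.coe_add, Pi.add_apply, Finsupp.coe_smul, Pi.smul_apply,
          smul_eq_mul] at this
        exact (Nat.dvd_add_left (hb i)).1 (this ▸ dvd_mul_right _ _)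
      exfalso
      apply hnot
      have hdiv {u : σ →₀ ℕ} (hu : ∀ i, N ∣ u i) :
          N • u.mapRange (· / N) (Nat.zero_div N) = u := by
        ext i
        simp [Nat.mul_div_cancel' (hu i)]
      refine ⟨(a.mapRange (· / N) (Nat.zero_div N), b.mapRange (· / N) (Nat.zero_div N)), ?_, ?_⟩
      · simp only [mem_coe, HasAntidiagonal.mem_antidiagonal]
        ext i
        have := DFunLike.congr_fun h i
        simp only [Finsupp.coe_add, Pi.add_apply, Finsupp.coe_smul, Pi.smul_apply,
          smul_eq_mul, Finsupp.mapRange_apply] at this ⊢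
        rw [← Nat.add_div_of_dvd_left (hb i), this, Nat.mul_div_cancel_left _ (by omega)]
      · simp [hdiv ha, hdiv hb]
    · push Not at hb
      obtain ⟨i, hi⟩ := hb
      simp [coeff_expand_of_not_dvd Q hi]
  · rintro ⟨a, b⟩ -
    simp [coeff_expand_smul N hN]

lemma rename_boxProd (k n : ℕ) (σ : ℕ → Equiv.Perm ℕ)
    (hσ : ∀ m a, σ m a ∈ Icc 1 (dimv k n m) ↔ a ∈ Icc 1 (dimv k n m)) :
    rename (fun x : ℕ × ℕ => (x.1, σ x.1 x.2)) (boxProd R k n) = boxProd R k n := by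
  simp only [boxProd, map_prod, rename_X]
  exact Finset.prod_congr rfl fun m _ =>
    Finset.prod_equiv (σ m) (fun a => (hσ m a).symm) fun _ _ => rfl

lemma rename_superpotential {k n : ℕ} (hn : 2 * k ≤ n) (σ : ℕ → Equiv.Perm ℕ)
    (hσ : ∀ m a, σ m a ∈ Icc 1 (dimv k n m) ↔ a ∈ Icc 1 (dimv k n m)) (z q : R) (a b c : ℕ) :
    rename (fun x : ℕ × ℕ => (x.1, σ x.1 x.2)) (superpotential z q k n a b c) =
      superpotential z q k n a b c := by
  have hk₁ : dimv k n k = k := by unfold dimv; omega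
  have hk₂ : dimv k n (n - k) = k := by unfold dimv; omega
  have h₁ := hσ k
  have h₂ := hσ (n - k)
  rw [hk₁] at h₁
  rw [hk₂] at h₂
  rw [superpotential, map_mul, map_mul, map_mul, map_pow, rename_boxProd k n σ hσ]
  simp only [map_mul, map_prod, map_sub, map_one, rename_X, rename_C, Finset.prod_mul_distrib]
  refine congrArg₂ (· * ·) (congrArg₂ (· * ·) (congrArg₂ (· * ·) rfl ?_) ?_)
    (congrArg₂ (· * ·) ?_ ?_)
  · refine Finset.prod_congr rfl fun m _ =>
      Finset.prod_equiv ((σ m).prodCongr (σ m)) (fun ij => ?_) fun _ _ => rfl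
    simp only [Finset.mem_filter, Finset.mem_product, Equiv.prodCongr_apply, Prod.map_fst,
      Prod.map_snd, hσ, ne_eq, EmbeddingLike.apply_eq_iff_eq]
  · exact Finset.prod_congr rfl fun m _ =>
      Finset.prod_equiv (σ m) (fun a => (hσ m a).symm) fun i _ =>
      Finset.prod_equiv (σ (m + 1)) (fun a => (hσ (m + 1) a).symm) fun _ _ => rfl
  · exact Finset.prod_equiv (σ k) (fun a => (h₁ a).symm) fun _ _ => rfl
  · exact Finset.prod_equiv (σ (n - k)) (fun a => (h₂ a).symm) fun _ _ => rfl

lemma prod_Icc_one_eq_prod_fin (v : ℕ) (g : ℕ → R) :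
    ∏ a ∈ Icc 1 v, g a = ∏ i : Fin v, g (i + 1) := by
  rw [Fin.prod_univ_eq_prod_range (fun i => g (i + 1)), ← Finset.Ico_add_one_right_eq_Icc,
    Finset.prod_Ico_eq_prod_range]
  simp [add_comm]

lemma prod_filter_lt_eq_prod_fin (v : ℕ) (h : ℕ → ℕ → R) :
    ∏ ij ∈ ((Icc 1 v) ×ˢ (Icc 1 v)).filter (fun ij => ij.1 < ij.2), h ij.1 ij.2 =
      ∏ i : Fin v, ∏ j ∈ Finset.Ioi i, h (i + 1) (j + 1) := by
  rw [Finset.prod_filter, Finset.prod_product, prod_Icc_one_eq_prod_fin]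
  refine Finset.prod_congr rfl fun i _ => ?_
  rw [prod_Icc_one_eq_prod_fin, ← Finset.filter_lt_eq_Ioi, Finset.prod_filter]
  simp

lemma prod_filter_lt_swap {v i j : ℕ} (hi : i ∈ Icc 1 v) (hj : j ∈ Icc 1 v) (hij : i ≠ j)
    (g : ℕ → R) :
    ∏ ab ∈ ((Icc 1 v) ×ˢ (Icc 1 v)).filter (fun ij => ij.1 < ij.2),
        (g (Equiv.swap i j ab.2) - g (Equiv.swap i j ab.1)) =
      -∏ ab ∈ ((Icc 1 v) ×ˢ (Icc 1 v)).filter (fun ij => ij.1 < ij.2), (g ab.2 - g ab.1) := by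
  rw [prod_filter_lt_eq_prod_fin v (fun a b => g (Equiv.swap i j b) - g (Equiv.swap i j a)),
    prod_filter_lt_eq_prod_fin v (fun a b => g b - g a)]
  rw [Finset.mem_Icc] at hi hj
  let i' : Fin v := ⟨i - 1, by omega⟩
  let j' : Fin v := ⟨j - 1, by omega⟩
  have hij' : i' ≠ j' := by
    simp only [i', j', ne_eq, Fin.mk.injEq]
    omega
  have hs (a : Fin v) : Equiv.swap i j (a + 1) = (Equiv.swap i' j' a : Fin v) + 1 := by
    simp only [Equiv.swap_apply_def, i', j', Fin.ext_iff]
    split_ifs <;> first | omega | (simp only; omega)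
  have := Equiv.Perm.prod_Ioi_comp_eq_sign_mul_prod (Equiv.swap i' j')
    (f := fun a b : Fin v => g (b + 1) - g (a + 1)) (fun _ _ => (neg_sub _ _).symm)
  simpa [hs, Equiv.Perm.sign_swap hij'] using this

lemma rename_vandProd_swap {k n m i j : ℕ} (hm : m ∈ Icc 1 (n - 1))
    (hi : i ∈ Icc 1 (dimv k n m)) (hj : j ∈ Icc 1 (dimv k n m)) (hij : i ≠ j) :
    rename (fun x : ℕ × ℕ => (x.1, (if x.1 = m then Equiv.swap i j else 1) x.2))
      (vandProd R k n) = -vandProd R k n := by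
  simp only [vandProd, map_prod, map_sub, rename_X]
  rw [← Finset.mul_prod_erase _ _ hm, ← Finset.mul_prod_erase _ _ hm, neg_mul_eq_neg_mul]
  congr 1
  · simpa using prod_filter_lt_swap hi hj hij (fun a => (X (m, a) : MvPolynomial (ℕ × ℕ) R))
  · refine Finset.prod_congr rfl fun m' hm' => ?_
    simp [Finset.ne_of_mem_erase hm']

lemma rename_swap_eq_neg {k n m i j : ℕ} (hn : 2 * k ≤ n) (hm : m ∈ Icc 1 (n - 1))
    (hi : i ∈ Icc 1 (dimv k n m)) (hj : j ∈ Icc 1 (dimv k n m)) (hij : i ≠ j) (z q : R)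
    (a b c : ℕ) :
    rename (Equiv.swap (m, i) (m, j))
        (boxProd R k n * vandProd R k n * superpotential z q k n a b c) =
      -(boxProd R k n * vandProd R k n * superpotential z q k n a b c) := by
  have hfun : (Equiv.swap (m, i) (m, j) : ℕ × ℕ → ℕ × ℕ) =
      fun x => (x.1, (if x.1 = m then Equiv.swap i j else 1) x.2) := by
    funext ⟨m', a⟩
    by_cases h : m' = m
    · subst h
      simp only [Equiv.swap_apply_def, Prod.mk.injEq, true_and, if_true]
      split_ifs <;> rfl
    · simp [Equiv.swap_apply_def, h]
  have hσ (m' a : ℕ) : (if m' = m then Equiv.swap i j else 1) a ∈ Icc 1 (dimv k n m') ↔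
      a ∈ Icc 1 (dimv k n m') := by
    split_ifs with h
    · subst h
      rw [Equiv.swap_apply_def]
      split_ifs <;> simp_all
    · rfl
  rw [hfun, map_mul, map_mul, rename_vandProd_swap hm hi hj hij,
    rename_boxProd k n (fun m' => if m' = m then Equiv.swap i j else 1) hσ,
    rename_superpotential hn (fun m' => if m' = m then Equiv.swap i j else 1) hσ]
  ring

/-- The set of indices `(i, j)` of the variables `x_{i,j}`. -/
def gridIndex (k n : ℕ) : Finset (ℕ × ℕ) :=
  (Icc 1 (n - 1) ×ˢ Icc 1 k).filter fun x => x.2 ≤ dimv k n x.1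

lemma mem_gridIndex {k n : ℕ} {x : ℕ × ℕ} :
    x ∈ gridIndex k n ↔ x.1 ∈ Icc 1 (n - 1) ∧ x.2 ∈ Icc 1 (dimv k n x.1) := by
  simp only [gridIndex, Finset.mem_filter, Finset.mem_product, Finset.mem_Icc]
  unfold dimv
  omega

/-- The exponent vector of `∏ x_{i,j}^{g j}`. -/
noncomputable def gridVec (k n : ℕ) (g : ℕ → ℕ) : (ℕ × ℕ) →₀ ℕ :=
  ∑ i ∈ Icc 1 (n - 1), ∑ j ∈ Icc 1 (dimv k n i), Finsupp.single (i, j) (g j)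

lemma gridVec_apply (k n : ℕ) (g : ℕ → ℕ) (x : ℕ × ℕ) :
    gridVec k n g x = if x ∈ gridIndex k n then g x.2 else 0 := by
  obtain ⟨m, a⟩ := x
  simp only [gridVec, Finsupp.finsetSum_apply, Finsupp.single_apply, Prod.mk.injEq,
    mem_gridIndex]
  simp only [ite_and, Finset.sum_ite_eq', Finset.sum_ite_irrel, Finset.sum_const_zero]

/-- A function of exponent vectors which changes sign when two variables of the same group are
interchanged, and is supported on vectors whose `i`-th group has entries in `{1, …, v_i}`. -/
structure IsGridAlternating (k n : ℕ) (c : ((ℕ × ℕ) →₀ ℕ) → R) : Prop where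
  swap : ∀ m i j, (m, i) ∈ gridIndex k n → (m, j) ∈ gridIndex k n → i ≠ j → ∀ d,
    c (d.mapDomain (Equiv.swap (m, i) (m, j))) = -c d
  mem_Icc : ∀ d, c d ≠ 0 → ∀ x ∈ gridIndex k n, d x ∈ Icc 1 (dimv k n x.1)
  eq_zero : ∀ d, c d ≠ 0 → ∀ x ∉ gridIndex k n, d x = 0

lemma IsGridAlternating.mul_eq_mul [NoZeroDivisors R] [CharZero R] {k n : ℕ}
    {c c' : ((ℕ × ℕ) →₀ ℕ) → R} (hc : IsGridAlternating k n c) (hc' : IsGridAlternating k n c')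
    (d : (ℕ × ℕ) →₀ ℕ) :
    c d * c' (gridVec k n id) = c (gridVec k n id) * c' d := by
  induction hM : ((gridIndex k n).filter fun x => d x ≠ x.2).card using Nat.strong_induction_on
    generalizing d with
  | _ M ih =>
  by_cases hz : c d = 0 ∧ c' d = 0
  · simp [hz.1, hz.2]
  have hmem : ∀ x ∈ gridIndex k n, d x ∈ Icc 1 (dimv k n x.1) := by
    by_cases h : c d = 0
    · exact hc'.mem_Icc d fun h' => hz ⟨h, h'⟩
    · exact hc.mem_Icc d h
  have hzero : ∀ x ∉ gridIndex k n, d x = 0 := by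
    by_cases h : c d = 0
    · exact hc'.eq_zero d fun h' => hz ⟨h, h'⟩
    · exact hc.eq_zero d h
  by_cases hne : ∃ x ∈ gridIndex k n, d x ≠ x.2
  · obtain ⟨⟨m, j⟩, hj, hdj⟩ := hne
    have hm := (mem_gridIndex.1 hj).1
    have hmap (i i' : ℕ) (x : ℕ × ℕ) : d.mapDomain (Equiv.swap (m, i) (m, i')) x =
        d (Equiv.swap (m, i) (m, i') x) := by
      rw [Finsupp.mapDomain_equiv_apply, Equiv.symm_swap]
    have hinj : Set.InjOn (fun i => d (m, i)) (Icc 1 (dimv k n m) : Finset ℕ) := by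
      intro i hi i' hi' h
      by_contra hii
      have hfix : d.mapDomain (Equiv.swap (m, i) (m, i')) = d := by
        ext x
        rw [hmap, Equiv.swap_apply_def]
        simp only at h
        split_ifs with h1 h2
        · rw [h1, h]
        · rw [h2, h]
        · rfl
      have h1 := hc.swap m i i' (mem_gridIndex.2 ⟨hm, hi⟩) (mem_gridIndex.2 ⟨hm, hi'⟩) hii d
      have h2 := hc'.swap m i i' (mem_gridIndex.2 ⟨hm, hi⟩) (mem_gridIndex.2 ⟨hm, hi'⟩) hii d
      rw [hfix] at h1 h2
      exact hz ⟨self_eq_neg.1 h1, self_eq_neg.1 h2⟩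
    obtain ⟨i, hi, hdi⟩ := Finset.surj_on_of_inj_on_of_card_le
      (s := Icc 1 (dimv k n m)) (t := Icc 1 (dimv k n m)) (fun i _ => d (m, i))
      (fun i hi => hmem (m, i) (mem_gridIndex.2 ⟨hm, hi⟩))
      (fun i i' hi hi' h => hinj hi hi' h) le_rfl j (mem_gridIndex.1 hj).2
    have hij : i ≠ j := by
      rintro rfl
      exact hdj hdi.symm
    have hi' : (m, i) ∈ gridIndex k n := mem_gridIndex.2 ⟨hm, hi⟩
    have key := ih _ ?_ (d.mapDomain (Equiv.swap (m, i) (m, j))) rfl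
    · rw [hc.swap m i j hi' hj hij, hc'.swap m i j hi' hj hij] at key
      simpa using key
    · rw [← hM]
      refine Finset.card_lt_card ((Finset.ssubset_iff_of_subset ?_).2 ⟨(m, j), ?_, ?_⟩)
      · intro x hx
        rw [Finset.mem_filter, hmap, Equiv.swap_apply_def] at hx
        rw [Finset.mem_filter]
        refine ⟨hx.1, ?_⟩
        by_cases h1 : x = (m, i)
        · subst h1
          simpa [← hdi] using hij.symm
        by_cases h2 : x = (m, j)
        · subst h2
          exact hdj
        simpa [h1, h2] using hx.2
      · exact Finset.mem_filter.2 ⟨hj, hdj⟩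
      · simp [hmap, hdi.symm]
  · push Not at hne
    have : d = gridVec k n id := by
      ext x
      rw [gridVec_apply]
      split_ifs with hx
      · exact hne x hx
      · exact hzero x hx
    rw [this]

/-- With respect to the additive weight `w`, the exponent `e` strictly dominates all other
exponents of `f`, and its coefficient is `1`. -/
structure IsMonicAt {σ : Type*} (w : (σ →₀ ℕ) →+ ℕ) (f : MvPolynomial σ R) (e : σ →₀ ℕ) :
    Prop where
  coeff_eq_one : coeff e f = 1
  lt_of_ne : ∀ d, coeff d f ≠ 0 → d ≠ e → w d < w e

lemma IsMonicAt.one {σ : Type*} (w : (σ →₀ ℕ) →+ ℕ) :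
    IsMonicAt w (1 : MvPolynomial σ R) 0 := by
  classical
  refine ⟨by simp, fun d hd hne => absurd ?_ hd⟩
  rw [coeff_one, if_neg hne.symm]

lemma IsMonicAt.mul {σ : Type*} {w : (σ →₀ ℕ) →+ ℕ} {f g : MvPolynomial σ R}
    {e e' : σ →₀ ℕ} (hf : IsMonicAt w f e) (hg : IsMonicAt w g e') :
    IsMonicAt w (f * g) (e + e') := by
  classical
  have lef (d) (hd : coeff d f ≠ 0) : w d ≤ w e := by
    by_cases h : d = e
    · rw [h]
    · exact (hf.lt_of_ne d hd h).le
  have leg (d) (hd : coeff d g ≠ 0) : w d ≤ w e' := by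
    by_cases h : d = e'
    · rw [h]
    · exact (hg.lt_of_ne d hd h).le
  constructor
  · rw [coeff_mul, Finset.sum_eq_single_of_mem (e, e') (by simp), hf.coeff_eq_one,
      hg.coeff_eq_one, one_mul]
    rintro ⟨d, d'⟩ hd hne
    rw [HasAntidiagonal.mem_antidiagonal] at hd
    by_contra h
    have hsum := congrArg w hd
    simp only [map_add] at hsum
    have h1 := left_ne_zero_of_mul h
    have h2 := right_ne_zero_of_mul h
    have h3 := lef d h1
    have h4 := leg d' h2
    by_cases hde : d = e
    · subst hde
      exact hne (congrArg _ (add_left_cancel hd))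
    · have := hf.lt_of_ne d h1 hde
      omega
  · intro d hd hne
    rw [coeff_mul] at hd
    obtain ⟨⟨x, y⟩, hxy, h⟩ := Finset.exists_ne_zero_of_sum_ne_zero hd
    rw [HasAntidiagonal.mem_antidiagonal] at hxy
    simp only at hxy h
    have h1 := left_ne_zero_of_mul h
    have h2 := right_ne_zero_of_mul h
    have h3 := lef x h1
    have h4 := leg y h2
    rw [← hxy, map_add, map_add]
    by_cases hx : x = e
    · have hy : y ≠ e' := fun hy => hne (by rw [← hxy, hx, hy])
      have := hg.lt_of_ne y h2 hy
      omega
    · have := hf.lt_of_ne x h1 hx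
      omega

lemma IsMonicAt.prod {σ ι : Type*} {w : (σ →₀ ℕ) →+ ℕ} (s : Finset ι)
    {f : ι → MvPolynomial σ R} {e : ι → σ →₀ ℕ} (h : ∀ i ∈ s, IsMonicAt w (f i) (e i)) :
    IsMonicAt w (∏ i ∈ s, f i) (∑ i ∈ s, e i) := by
  classical
  induction s using Finset.induction_on with
  | empty => simpa using IsMonicAt.one w
  | insert i s hi ih =>
    rw [Finset.prod_insert hi, Finset.sum_insert hi]
    exact (h i (Finset.mem_insert_self i s)).mul
      (ih fun j hj => h j (Finset.mem_insert_of_mem hj))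

lemma isMonicAt_X_sub_X {σ : Type*} {w : (σ →₀ ℕ) →+ ℕ} {x y : σ}
    (hxy : w (Finsupp.single y 1) < w (Finsupp.single x 1)) :
    IsMonicAt w (X x - X y : MvPolynomial σ R) (Finsupp.single x 1) := by
  classical
  have hne : Finsupp.single y 1 ≠ (Finsupp.single x 1 : σ →₀ ℕ) := fun h => by simp [h] at hxy
  constructor
  · rw [coeff_sub, coeff_X, coeff_X, if_pos rfl, if_neg hne, sub_zero]
  · intro d hd hdx
    rw [coeff_sub, coeff_X, coeff_X, if_neg hdx.symm] at hd
    by_cases h : Finsupp.single y 1 = d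
    · rwa [← h]
    · simp [h] at hd

lemma boxProd_eq_monomial (k n : ℕ) :
    boxProd R k n = monomial (gridVec k n fun _ => 1) 1 := by
  simp only [boxProd, gridVec, monomial_sum_one, X]

lemma coeff_gridVec_vandProd (k n : ℕ) :
    coeff (gridVec k n (· - 1)) (vandProd R k n) = 1 := by
  let w : ((ℕ × ℕ) →₀ ℕ) →+ ℕ := Finsupp.liftAddHom fun x => AddMonoidHom.mulLeft x.2
  have hw (x : ℕ × ℕ) : w (Finsupp.single x 1) = x.2 := by simp [w]
  have h : IsMonicAt w (vandProd R k n) (∑ m ∈ Icc 1 (n - 1),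
      ∑ ij ∈ ((Icc 1 (dimv k n m)) ×ˢ (Icc 1 (dimv k n m))).filter (fun ij => ij.1 < ij.2),
        Finsupp.single (m, ij.2) 1) :=
    IsMonicAt.prod _ fun m _ => IsMonicAt.prod _ fun ij hij => isMonicAt_X_sub_X <| by
      simpa [hw] using (Finset.mem_filter.1 hij).2
  convert h.coeff_eq_one using 2
  refine Finset.sum_congr rfl fun m _ => ?_
  rw [Finset.sum_filter, Finset.sum_product_right]
  refine Finset.sum_congr rfl fun b hb => ?_
  simp only
  rw [← Finset.sum_filter, Finset.sum_const, Finsupp.smul_single, smul_eq_mul, mul_one]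
  congr 1
  rw [← Nat.card_Ico]
  congr 1
  ext a
  simp only [Finset.mem_Icc, Finset.mem_Ico, Finset.mem_filter] at hb ⊢
  omega

lemma coeff_gridVec_boxProd_mul (k n : ℕ) {g : ℕ → ℕ} (hg : ∀ j, 1 ≤ j → 1 ≤ g j)
    (f : MvPolynomial (ℕ × ℕ) R) :
    coeff (gridVec k n g) (boxProd R k n * f) = coeff (gridVec k n fun j => g j - 1) f := by
  have : gridVec k n g = gridVec k n (fun _ => 1) + gridVec k n (fun j => g j - 1) := by
    ext x
    simp only [Finsupp.coe_add, Pi.add_apply, gridVec_apply]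
    split_ifs with hx
    · have := hg x.2 (Finset.mem_Icc.1 (mem_gridIndex.1 hx).2).1
      omega
    · rfl
  rw [this, boxProd_eq_monomial, coeff_monomial_mul, one_mul]

lemma degreeOf_X_sub_C_mul_X_le [Nontrivial R] {σ : Type*} [DecidableEq σ] (x y y' : σ) (r : R) :
    degreeOf x (X y - C r * X y') ≤ (if x = y then 1 else 0) + (if x = y' then 1 else 0) := by
  refine (degreeOf_sub_le _ _ _).trans ?_
  have h := degreeOf_C_mul_le (X y' : MvPolynomial σ R) x r
  rw [degreeOf_X] at h ⊢
  exact max_le (by omega) (by omega)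

lemma degreeOf_C_sub_C_mul_X_le [Nontrivial R] {σ : Type*} [DecidableEq σ] (x y : σ) (z r : R) :
    degreeOf x (C z - C r * X y) ≤ if x = y then 1 else 0 := by
  refine (degreeOf_sub_le _ _ _).trans ?_
  have h := degreeOf_C_mul_le (X y : MvPolynomial σ R) x r
  rw [degreeOf_X] at h
  rw [degreeOf_C]
  exact max_le (by omega) (by omega)

lemma degreeOf_prod_le_sum {σ ι : Type*} {x : σ} {s : Finset ι} {f : ι → MvPolynomial σ R}
    {g : ι → ℕ} (h : ∀ i ∈ s, degreeOf x (f i) ≤ g i) :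
    degreeOf x (∏ i ∈ s, f i) ≤ ∑ i ∈ s, g i :=
  (degreeOf_prod_le _ _ _).trans (Finset.sum_le_sum h)

lemma degreeOf_prod_range_le {σ : Type*} {x : σ} {f : ℕ → MvPolynomial σ R} {t g : ℕ}
    (h : ∀ i, degreeOf x (f i) ≤ g) :
    degreeOf x (∏ i ∈ range t, f i) ≤ t * g := by
  simpa using degreeOf_prod_le_sum (s := range t) (g := fun _ => g) fun i _ => h i

lemma sum_filter_ite_fst {s : Finset ℕ} {j : ℕ} (hj : j ∈ s) (P : ℕ × ℕ → Prop)
    [DecidablePred P] :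
    ∑ ij ∈ (s ×ˢ s).filter P, (if j = ij.1 then 1 else 0) = #(s.filter fun b => P (j, b)) := by
  rw [Finset.sum_filter, Finset.sum_product, Finset.sum_eq_single_of_mem j hj, Finset.card_filter]
  · simp
  · intro a _ h
    simp [h.symm]

lemma sum_filter_ite_snd {s : Finset ℕ} {j : ℕ} (hj : j ∈ s) (P : ℕ × ℕ → Prop)
    [DecidablePred P] :
    ∑ ij ∈ (s ×ˢ s).filter P, (if j = ij.2 then 1 else 0) = #(s.filter fun a => P (a, j)) := by
  rw [Finset.sum_filter, Finset.sum_product_right, Finset.sum_eq_single_of_mem j hj,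
    Finset.card_filter]
  · simp
  · intro a _ h
    simp [h.symm]

lemma degreeOf_boxProd_le [Nontrivial R] (k n : ℕ) (x : ℕ × ℕ) :
    degreeOf x (boxProd R k n) ≤ if x ∈ gridIndex k n then 1 else 0 := by
  rw [boxProd_eq_monomial, degreeOf_monomial_eq _ _ one_ne_zero, gridVec_apply]

lemma degreeOf_prod_pairs_le {k n : ℕ} (P : ℕ × ℕ → Prop) [DecidablePred P] (x : ℕ × ℕ)
    (f : ℕ → ℕ × ℕ → MvPolynomial (ℕ × ℕ) R) (t u : ℕ)
    (hf : ∀ m ij, degreeOf x (f m ij) ≤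
      t * ((if x = (m, ij.1) then 1 else 0) + (if x = (m, ij.2) then 1 else 0)))
    (hu : x ∈ gridIndex k n → #((Icc 1 (dimv k n x.1)).filter fun b => P (x.2, b)) +
      #((Icc 1 (dimv k n x.1)).filter fun a => P (a, x.2)) ≤ u) :
    degreeOf x (∏ m ∈ Icc 1 (n - 1),
      ∏ ij ∈ ((Icc 1 (dimv k n m)) ×ˢ (Icc 1 (dimv k n m))).filter P, f m ij) ≤
      if x ∈ gridIndex k n then t * u else 0 := by
  refine (degreeOf_prod_le_sum fun m _ => degreeOf_prod_le_sum fun ij _ => hf m ij).trans ?_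
  obtain ⟨m, j⟩ := x
  split_ifs with hx
  · have hx' := mem_gridIndex.1 hx
    rw [Finset.sum_eq_single_of_mem m hx'.1, ← Finset.mul_sum]
    · refine Nat.mul_le_mul_left _ (le_trans (le_of_eq ?_) (hu hx))
      simp only [Prod.mk.injEq, true_and]
      rw [Finset.sum_add_distrib, sum_filter_ite_fst hx'.2, sum_filter_ite_snd hx'.2]
    · intro m' _ h
      simp [h.symm]
  · refine le_of_eq (Finset.sum_eq_zero fun m' hm' => Finset.sum_eq_zero fun ij hij => ?_)
    have hij := Finset.mem_product.1 (Finset.mem_filter.1 hij).1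
    rw [if_neg, if_neg, add_zero, mul_zero]
    · rintro h
      exact hx (h ▸ mem_gridIndex.2 ⟨hm', hij.2⟩)
    · rintro h
      exact hx (h ▸ mem_gridIndex.2 ⟨hm', hij.1⟩)

lemma degreeOf_vandProd_le [Nontrivial R] (k n : ℕ) (x : ℕ × ℕ) :
    degreeOf x (vandProd R k n) ≤ if x ∈ gridIndex k n then dimv k n x.1 - 1 else 0 := by
  have := degreeOf_prod_pairs_le (R := R) (k := k) (n := n) (fun ij => ij.1 < ij.2) x
    (fun m ij => X (m, ij.2) - X (m, ij.1)) 1 (dimv k n x.1 - 1) (fun m ij => ?_) (fun hx => ?_)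
  · simpa [vandProd] using this
  · have := degreeOf_X_sub_C_mul_X_le x (m, ij.2) (m, ij.1) (1 : R)
    rw [one_mul, add_comm]
    simpa using this
  · have hx' := Finset.mem_Icc.1 (mem_gridIndex.1 hx).2
    have h1 : (Icc 1 (dimv k n x.1)).filter (fun b => x.2 < b) = Finset.Ioc x.2 (dimv k n x.1) := by
      ext b
      simp only [Finset.mem_filter, Finset.mem_Icc, Finset.mem_Ioc]
      omega
    have h2 : (Icc 1 (dimv k n x.1)).filter (fun a => a < x.2) = Finset.Ico 1 x.2 := by
      ext b
      simp only [Finset.mem_filter, Finset.mem_Icc, Finset.mem_Ico]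
      omega
    simp only [h1, h2, Nat.card_Ioc, Nat.card_Ico]
    omega

lemma degreeOf_prod_edges_le [Nontrivial R] (k n : ℕ) (q : R) (c : ℕ) (x : ℕ × ℕ) :
    degreeOf x (∏ i ∈ Icc 1 (n - 2), ∏ a ∈ Icc 1 (dimv k n i), ∏ b ∈ Icc 1 (dimv k n (i + 1)),
      ∏ r ∈ range c, (X (i, a) - C (q ^ r) * X (i + 1, b))) ≤
      c * ∑ i ∈ Icc 1 (n - 2), ∑ a ∈ Icc 1 (dimv k n i), ∑ b ∈ Icc 1 (dimv k n (i + 1)),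
        ((if x = (i, a) then 1 else 0) + (if x = (i + 1, b) then 1 else 0)) := by
  simp only [Finset.mul_sum]
  exact degreeOf_prod_le_sum fun i _ => degreeOf_prod_le_sum fun a _ => degreeOf_prod_le_sum
      fun b _ => degreeOf_prod_range_le fun r => degreeOf_X_sub_C_mul_X_le _ _ _ _

lemma degreeOf_prod_framing_le [Nontrivial R] (k n : ℕ) (z q : R) (c : ℕ) (x : ℕ × ℕ) :
    degreeOf x (∏ i ∈ Icc 1 k, ∏ r ∈ range c,
      (C z - C (q ^ r) * X (k, i)) * (1 - C (q ^ r) * X (n - k, i))) ≤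
      c * ∑ i ∈ Icc 1 k, ((if x = (k, i) then 1 else 0) + (if x = (n - k, i) then 1 else 0)) := by
  rw [Finset.mul_sum]
  refine degreeOf_prod_le_sum fun i _ => degreeOf_prod_range_le fun r =>
    (degreeOf_mul_le _ _ _).trans (add_le_add (degreeOf_C_sub_C_mul_X_le _ _ _ _) ?_)
  rw [← C_1]
  exact degreeOf_C_sub_C_mul_X_le x (n - k, i) 1 (q ^ r)

lemma sum_edges_add_sum_framing_le {k n : ℕ} (hk : 1 ≤ k) (hn : 2 * k ≤ n) (x : ℕ × ℕ) :
    (∑ i ∈ Icc 1 (n - 2), ∑ a ∈ Icc 1 (dimv k n i), ∑ b ∈ Icc 1 (dimv k n (i + 1)),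
        ((if x = (i, a) then 1 else 0) + (if x = (i + 1, b) then 1 else 0))) +
      ∑ i ∈ Icc 1 k, ((if x = (k, i) then 1 else 0) + (if x = (n - k, i) then 1 else 0)) ≤
      if x ∈ gridIndex k n then 2 * dimv k n x.1 else 0 := by
  have hv₁ : dimv k n k = k := by unfold dimv; omega
  have hv₂ : dimv k n (n - k) = k := by unfold dimv; omega
  obtain ⟨m, j⟩ := x
  split_ifs with hx
  · have hx' := mem_gridIndex.1 hx
    simp only [Finset.mem_Icc] at hx'
    obtain ⟨m, rfl⟩ : ∃ m', m = m' + 1 := ⟨m - 1, by omega⟩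
    simp only [Prod.mk.injEq, ite_and, Finset.sum_add_distrib, add_left_inj,
      Finset.sum_ite_irrel, Finset.sum_const_zero, Finset.sum_ite_eq, Finset.sum_const,
      Finset.mem_Icc, smul_eq_mul, mul_one, Nat.card_Icc]
    unfold dimv at hx' ⊢
    split_ifs <;> omega
  · have hnot {y : ℕ × ℕ} (hy : y ∈ gridIndex k n) : (if (m, j) = y then 1 else 0) = (0 : ℕ) := by
      rw [if_neg]
      rintro rfl
      exact hx hy
    refine le_of_eq (add_eq_zero.2 ⟨?_, ?_⟩)
    · refine Finset.sum_eq_zero fun i hi => Finset.sum_eq_zero fun a ha =>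
        Finset.sum_eq_zero fun b hb => ?_
      rw [Finset.mem_Icc] at hi
      have h₁ : (i, a) ∈ gridIndex k n :=
        mem_gridIndex.2 ⟨Finset.mem_Icc.2 ⟨hi.1, by dsimp only; omega⟩, ha⟩
      have h₂ : (i + 1, b) ∈ gridIndex k n :=
        mem_gridIndex.2 ⟨Finset.mem_Icc.2 ⟨by dsimp only; omega, by dsimp only; omega⟩, hb⟩
      rw [hnot h₁, hnot h₂, add_zero]
    · refine Finset.sum_eq_zero fun i hi => ?_
      have h₁ : (k, i) ∈ gridIndex k n :=
        mem_gridIndex.2 ⟨Finset.mem_Icc.2 ⟨hk, by dsimp only; omega⟩, by rwa [hv₁]⟩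
      have h₂ : (n - k, i) ∈ gridIndex k n :=
        mem_gridIndex.2 ⟨Finset.mem_Icc.2 ⟨by dsimp only; omega, by dsimp only; omega⟩,
          by rwa [hv₂]⟩
      rw [hnot h₁, hnot h₂, add_zero]

/-- The variables `x_{i,j}` occur with degree at most `v_i + a + 2(v_i - 1)b + 2 v_i c`, and all
other variables are absent. -/
lemma degreeOf_boxProd_mul_le [Nontrivial R] {k n : ℕ} (hk : 1 ≤ k) (hn : 2 * k ≤ n) (z q : R)
    (a b c : ℕ) (x : ℕ × ℕ) :
    degreeOf x (boxProd R k n * vandProd R k n * superpotential z q k n a b c) ≤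
      if x ∈ gridIndex k n then
        dimv k n x.1 + a + b * (2 * (dimv k n x.1 - 1)) + c * (2 * dimv k n x.1) else 0 := by
  have h₁ := degreeOf_boxProd_le (R := R) k n x
  have h₂ := degreeOf_vandProd_le (R := R) k n x
  have h₃ := (degreeOf_pow_le x (boxProd R k n) a).trans (Nat.mul_le_mul_left a h₁)
  have h₄ := degreeOf_prod_pairs_le (R := R) (k := k) (n := n) (fun ij => ij.1 ≠ ij.2) x
    (fun m ij => ∏ r ∈ range b, (X (m, ij.1) - C (q ^ r) * X (m, ij.2))) b
    (2 * (dimv k n x.1 - 1))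
    (fun m ij => degreeOf_prod_range_le fun r => degreeOf_X_sub_C_mul_X_le _ _ _ _)
    (fun hx => by
      have hx' := (mem_gridIndex.1 hx).2
      rw [Finset.filter_ne, Finset.filter_ne', Finset.card_erase_of_mem hx', Nat.card_Icc]
      omega)
  have h₅ := degreeOf_prod_edges_le k n q c x
  have h₆ := degreeOf_prod_framing_le k n z q c x
  have h₇ := Nat.mul_le_mul_left c (sum_edges_add_sum_framing_le hk hn x)
  rw [mul_add] at h₇
  refine (degreeOf_mul_le _ _ _).trans ((add_le_add ((degreeOf_mul_le _ _ _).trans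
    (add_le_add h₁ h₂)) ((degreeOf_mul_le _ _ _).trans (add_le_add ((degreeOf_mul_le _ _ _).trans
      (add_le_add ((degreeOf_mul_le _ _ _).trans (add_le_add h₃ h₄)) h₅)) h₆))).trans ?_)
  split_ifs at h₇ ⊢ with hx
  · have := Finset.mem_Icc.1 (mem_gridIndex.1 hx).2
    omega
  · omega

lemma X_dvd_boxProd {k n : ℕ} {x : ℕ × ℕ} (hx : x ∈ gridIndex k n) : X x ∣ boxProd R k n :=
  (Finset.dvd_prod_of_mem (fun j => X (x.1, j)) (mem_gridIndex.1 hx).2).trans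
    (Finset.dvd_prod_of_mem _ (mem_gridIndex.1 hx).1)

lemma isGridAlternating_coeff [Nontrivial R] {k n : ℕ} (hk : 1 ≤ k) (hn : 2 * k ≤ n) (z q : R)
    {N a b c : ℕ} (ha : a + c + 1 = N) (hb : 2 * b + 2 * c + 1 = N) :
    IsGridAlternating k n fun d =>
      coeff (N • d) (boxProd R k n * vandProd R k n * superpotential z q k n a b c) where
  swap m i j hi hj hij d := by
    have hm := (mem_gridIndex.1 hi).1
    rw [← Finsupp.mapDomain_smul]
    conv_lhs => rw [← neg_neg (boxProd R k n * vandProd R k n * superpotential z q k n a b c),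
      ← rename_swap_eq_neg hn hm (mem_gridIndex.1 hi).2 (mem_gridIndex.1 hj).2 hij z q a b c]
    rw [coeff_neg, coeff_rename_mapDomain _ (Equiv.injective _)]
  mem_Icc d hd x hx := by
    rw [Finset.mem_Icc]
    constructor
    · obtain ⟨f, hf⟩ := X_dvd_boxProd (R := R) hx
      by_contra h
      have h0 : d x = 0 := by omega
      refine hd ?_
      rw [hf, mul_assoc, mul_assoc, coeff_X_mul', if_neg]
      simp [h0]
    · have h := (degreeOf_le_iff.1 (degreeOf_boxProd_mul_le hk hn z q a b c x) _
        (mem_support_iff.2 hd))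
      rw [if_pos hx, Finsupp.smul_apply, smul_eq_mul] at h
      obtain ⟨v, hv⟩ : ∃ v, dimv k n x.1 = v + 1 :=
        ⟨dimv k n x.1 - 1, by have := Finset.mem_Icc.1 (mem_gridIndex.1 hx).2; omega⟩
      rw [hv, Nat.add_sub_cancel] at h
      rw [hv]
      by_contra hlt
      have hN := Nat.mul_le_mul_left N (show v + 2 ≤ d x by omega)
      have hbv : 2 * (b * v) + 2 * (c * v) + v = N * v := by rw [← hb]; ring
      have e1 : b * (2 * v) = 2 * (b * v) := by ring
      have e2 : c * (2 * (v + 1)) = 2 * (c * v) + 2 * c := by ring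
      have e3 : N * (v + 2) = N * v + 2 * N := by ring
      omega
  eq_zero d hd x hx := by
    have h := (degreeOf_le_iff.1 (degreeOf_boxProd_mul_le hk hn z q a b c x) _
      (mem_support_iff.2 hd))
    rw [if_neg hx, Finsupp.smul_apply, smul_eq_mul, Nat.le_zero, Nat.mul_eq_zero] at h
    omega

/-- The coefficient of `∏ x_{i,j}^{jN - 1}` in the superpotential times the Vandermonde
factors. -/
noncomputable def truncation (z q : R) (k n N a b c : ℕ) : R :=
  coeff (gridVec k n fun j => j * N - 1) (vandProd R k n * superpotential z q k n a b c)

lemma truncation_eq_coeff_gridVec (z q : R) (k n a b c : ℕ) {N : ℕ} (hN : 0 < N) :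
    truncation z q k n N a b c = coeff (gridVec k n (· * N))
      (boxProd R k n * vandProd R k n * superpotential z q k n a b c) := by
  rw [mul_assoc, coeff_gridVec_boxProd_mul k n fun j hj => Nat.mul_pos hj hN]
  rfl

lemma smul_gridVec (k n N : ℕ) (g : ℕ → ℕ) : N • gridVec k n g = gridVec k n fun j => g j * N := by
  ext x
  simp only [Finsupp.smul_apply, gridVec_apply, smul_eq_mul]
  split_ifs
  · exact mul_comm _ _
  · simp

lemma coeff_smul_eq_truncation_mul [IsDomain R] [CharZero R] {k n : ℕ} (hk : 1 ≤ k)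
    (hn : 2 * k ≤ n) (z q : R) {N a b c : ℕ} (ha : a + c + 1 = N) (hb : 2 * b + 2 * c + 1 = N)
    (d : (ℕ × ℕ) →₀ ℕ) :
    coeff (N • d) (boxProd R k n * vandProd R k n * superpotential z q k n a b c) =
      truncation z q k n N a b c * coeff d (boxProd R k n * vandProd R k n) := by
  have h := (isGridAlternating_coeff hk hn z q ha hb).mul_eq_mul
    (isGridAlternating_coeff hk hn z q (N := 1) (a := 0) (b := 0) (c := 0) rfl rfl) d
  simp only [superpotential_zero, mul_one, one_smul, smul_gridVec] at h
  rw [coeff_gridVec_boxProd_mul k n (g := id) fun j hj => hj] at h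
  simp only [id_eq] at h
  rw [coeff_gridVec_vandProd, mul_one] at h
  rw [h, truncation_eq_coeff_gridVec z q k n a b c (by omega)]

theorem truncation_eq_mul [IsDomain R] [CharZero R] {k n : ℕ} (hk : 1 ≤ k)
    (hn : 2 * k ≤ n) (z : R) {N a b c M a' b' c' : ℕ} (hM : 0 < M) (ha : a + c + 1 = N)
    (hb : 2 * b + 2 * c + 1 = N) {ζ : R} (hζ : IsPrimitiveRoot ζ N) :
    truncation z ζ k n (N * M) (a + N * a') (b + N * b') (c + N * c') =
      truncation z ζ k n N a b c * truncation (z ^ N) 1 k n M a' b' c' := by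
  have hN : 0 < N := by omega
  rw [truncation_eq_coeff_gridVec _ _ k n _ _ _ (Nat.mul_pos hN hM),
    truncation_eq_coeff_gridVec _ _ k n a' b' c' hM, superpotential_factor hN hζ, ← mul_assoc]
  have he : (gridVec k n fun j => j * (N * M)) = N • gridVec k n fun j => j * M := by
    rw [smul_gridVec]
    congr 1
    funext j
    ring
  rw [he, coeff_smul_mul_expand hN.ne', coeff_mul, Finset.mul_sum]
  refine Finset.sum_congr rfl fun d _ => ?_
  rw [coeff_smul_eq_truncation_mul hk hn z ζ ha hb, mul_assoc]

end Superpotential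

lemma evalQ_Ts (ζ : ℂ) (e p r₀ q₀ k n s : ℕ) :
    evalQ ζ e (Ts p r₀ q₀ k n s) =
      truncation (Polynomial.X ^ e) (Polynomial.C ζ) k n (p ^ s)
        (aExp p r₀ q₀ s) (bExp p r₀ q₀ s) (cExp p r₀ q₀ s) := by
  rw [Ts, ← coeff_map, map_Phi]
  simp only [evalQ, Zvar, Qvar, coe_eval₂Hom, eval₂_X]
  rfl

lemma evalQ_comp_X_pow (e N : ℕ) (ζ : ℂ) (t : Zq) :
    (evalQ ζ e t).comp (Polynomial.X ^ N) = evalQ ζ (N * e) t := by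
  have : (Polynomial.compRingHom (Polynomial.X ^ N)).comp (evalQ ζ e) = evalQ ζ (N * e) := by
    refine MvPolynomial.ringHom_ext (fun r => by simp) fun b => ?_
    cases b <;> simp [evalQ, pow_mul]
  simpa using congrArg (fun f : Zq →+* Polynomial ℂ => f t) this

section Exponents

variable {p r₀ q₀ : ℕ}

lemma exists_pow_eq_mul_add_one (hp : 0 < p) (hcong : p ≡ 1 [MOD q₀]) (s : ℕ) :
    ∃ u, p ^ s = q₀ * u + 1 := by
  have h : 1 ≡ p ^ s [MOD q₀] := by simpa using (hcong.pow s).symm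
  obtain ⟨u, hu⟩ := (Nat.modEq_iff_dvd' (Nat.one_le_pow _ _ hp)).1 h
  exact ⟨u, by have := Nat.one_le_pow s p hp; omega⟩

lemma cExp_eq_of_pow_eq (hq₀ : 0 < q₀) {s u : ℕ} (hu : p ^ s = q₀ * u + 1) :
    cExp p r₀ q₀ s = u * r₀ := by
  rw [cExp, hu, Nat.add_sub_cancel, mul_assoc, Nat.mul_div_cancel_left _ hq₀]

lemma aExp_add_cExp (hp : 0 < p) (hq₀ : 0 < q₀) (hω : 2 * r₀ ≤ q₀) (hcong : p ≡ 1 [MOD q₀])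
    (s : ℕ) : aExp p r₀ q₀ s + cExp p r₀ q₀ s + 1 = p ^ s := by
  obtain ⟨u, hu⟩ := exists_pow_eq_mul_add_one hp hcong s
  have h := Nat.mul_le_mul_left u hω
  rw [aExp, cExp_eq_of_pow_eq hq₀ hu, hu]
  rw [mul_comm u q₀, mul_left_comm] at h
  omega

lemma two_mul_bExp_add (hp : 0 < p) (hodd : Odd p) (hq₀ : 0 < q₀) (hω : 2 * r₀ ≤ q₀)
    (hcong : p ≡ 1 [MOD q₀]) (s : ℕ) :
    2 * bExp p r₀ q₀ s + 2 * cExp p r₀ q₀ s + 1 = p ^ s := by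
  obtain ⟨u, hu⟩ := exists_pow_eq_mul_add_one hp hcong s
  have h := Nat.mul_le_mul_left u hω
  obtain ⟨t, ht⟩ := hodd.pow (n := s)
  rw [bExp, cExp_eq_of_pow_eq hq₀ hu, hu]
  rw [mul_comm u q₀, mul_left_comm] at h
  omega

lemma cExp_add (hp : 0 < p) (hq₀ : 0 < q₀) (hcong : p ≡ 1 [MOD q₀]) (l m : ℕ) :
    cExp p r₀ q₀ (l + m) = cExp p r₀ q₀ l + p ^ l * cExp p r₀ q₀ m := by
  obtain ⟨u, hu⟩ := exists_pow_eq_mul_add_one hp hcong l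
  obtain ⟨v, hv⟩ := exists_pow_eq_mul_add_one hp hcong m
  have huv : p ^ (l + m) = q₀ * (u + p ^ l * v) + 1 := by
    rw [pow_add, hv, mul_add, mul_one]
    nth_rw 2 [hu]
    ring
  rw [cExp_eq_of_pow_eq hq₀ huv, cExp_eq_of_pow_eq hq₀ hu, cExp_eq_of_pow_eq hq₀ hv]
  ring

end Exponents

theorem evalQ_Ts_add {p r₀ q₀ k n : ℕ} (hp : 0 < p) (hodd : Odd p) (hq₀ : 0 < q₀)
    (hω : 2 * r₀ ≤ q₀) (hcong : p ≡ 1 [MOD q₀]) (hk : 1 ≤ k) (hn : 2 * k ≤ n) (l m e : ℕ) {ζ : ℂ}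
    (hζ : IsPrimitiveRoot ζ (p ^ l)) :
    evalQ ζ e (Ts p r₀ q₀ k n (l + m)) =
      evalQ ζ e (Ts p r₀ q₀ k n l) * evalQ 1 (e * p ^ l) (Ts p r₀ q₀ k n m) := by
  have hA := aExp_add_cExp hp hq₀ hω hcong
  have hB := two_mul_bExp_add hp hodd hq₀ hω hcong
  have hc := cExp_add (r₀ := r₀) hp hq₀ hcong l m
  have ha : aExp p r₀ q₀ (l + m) = aExp p r₀ q₀ l + p ^ l * aExp p r₀ q₀ m := by
    have h := congrArg (p ^ l * ·) (hA m)
    simp only [mul_add, mul_one, ← pow_add] at h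
    have := hA l
    have := hA (l + m)
    omega
  have hb : bExp p r₀ q₀ (l + m) = bExp p r₀ q₀ l + p ^ l * bExp p r₀ q₀ m := by
    have h := congrArg (p ^ l * ·) (hB m)
    simp only [mul_add, mul_one, ← pow_add, mul_left_comm _ 2] at h
    have := hB l
    have := hB (l + m)
    omega
  rw [evalQ_Ts, evalQ_Ts, evalQ_Ts, ha, hb, hc, pow_add, pow_mul, Polynomial.C_1]
  exact truncation_eq_mul hk hn _ (Nat.pow_pos hp) (hA l) (hB l)
    (hζ.map_of_injective Polynomial.C_injective)

/-- At a primitive `p^l`-th root of unity `ζ` (with `1 ≤ l ≤ s`), there is a single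
polynomial `F ∈ ℂ[z]` with `T_{s+1}(z,ζ) = T_l(z,ζ)·F(z^{p^l})` and
`T_s(z^p,ζ^p) = T_{l-1}(z^p,ζ^p)·F(z^{p^l})` (the cofactors `F₁` and `G₁` coincide). -/
theorem common_cofactor (p r₀ q₀ k n : ℕ) (hp : p.Prime) (hodd : Odd p)
    (hr₀ : 0 < r₀) (hq₀ : 0 < q₀) (hω : 2 * r₀ ≤ q₀) (hcong : p ≡ 1 [MOD q₀])
    (hk : 1 ≤ k) (hn : 2 * k ≤ n) (l s : ℕ) (hl : 1 ≤ l) (hls : l ≤ s)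
    (ζ : ℂ) (hζ : IsPrimitiveRoot ζ (p ^ l)) :
    ∃ F : Polynomial ℂ,
      evalQ ζ 1 (Ts p r₀ q₀ k n (s + 1)) =
        evalQ ζ 1 (Ts p r₀ q₀ k n l) * F.comp (Polynomial.X ^ p ^ l) ∧
      evalQ (ζ ^ p) p (Ts p r₀ q₀ k n s) =
        evalQ (ζ ^ p) p (Ts p r₀ q₀ k n (l - 1)) * F.comp (Polynomial.X ^ p ^ l) := by
  have hp₀ := hp.pos
  have hpl : p ^ l = p * p ^ (l - 1) := by rw [← pow_succ', Nat.sub_add_cancel hl]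
  obtain ⟨m, rfl⟩ : ∃ m, s = l - 1 + m := ⟨s - (l - 1), by omega⟩
  refine ⟨evalQ 1 1 (Ts p r₀ q₀ k n m), ?_, ?_⟩
  · rw [evalQ_comp_X_pow, mul_one, show l - 1 + m + 1 = l + m by omega,
      evalQ_Ts_add hp₀ hodd hq₀ hω hcong hk hn l m 1 hζ, one_mul]
  · have hζ' : IsPrimitiveRoot (ζ ^ p) (p ^ (l - 1)) := hζ.pow (Nat.pow_pos hp₀) hpl
    rw [evalQ_comp_X_pow, mul_one, hpl,
      evalQ_Ts_add hp₀ hodd hq₀ hω hcong hk hn (l - 1) m p hζ']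
end

section
/- For every integer s ≥ 1, the q-deformed Dwork congruence holds for the T*ℙ¹ truncations: [p^s]_q divides S_{s+1}(z,q)·S_{s−1}(z^p,q^p) − S_s(z,q)·S_s(z^p,q^p) in ℤ[z,q]. -/
open Finset

/-- The truncation `S_s(z,q)` of the K-theoretic vertex function of `T*ℙ¹`
(i.e. `T*Gr(1,2)` with `ω = 1/2`): `(-1)^{(p^s-1)/2}` times the coefficient of
`x^{p^s-1}` in `x^{(p^s-1)/2} · ∏_{r=0}^{(p^s-1)/2-1} (z - q^r x)(1 - q^r x)`. -/
noncomputable def Svert (p s : ℕ) : Zq :=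
  (-1) ^ ((p ^ s - 1) / 2) *
    Polynomial.coeff
      (Polynomial.X ^ ((p ^ s - 1) / 2) *
        ∏ r ∈ range ((p ^ s - 1) / 2),
          ((Polynomial.C Zvar - Polynomial.C (Qvar ^ r) * Polynomial.X) *
            (1 - Polynomial.C (Qvar ^ r) * Polynomial.X)))
      (p ^ s - 1)

/-- The ring map `ℤ[z,q] → ℤ[z,q]` sending `z ↦ z^p`, `q ↦ q^p`. -/
noncomputable def frobZq (p : ℕ) : Zq →+* Zq :=
  MvPolynomial.eval₂Hom (Int.castRingHom Zq) (fun b => (MvPolynomial.X b) ^ p)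

/-- `(-1)^m` times the coefficient of `x^m` in `∏_{r < m} (z - q^r x)(1 - q^r x)`. -/
noncomputable def centralCoeff {R : Type*} [CommRing R] (z q : R) (m : ℕ) : R :=
  (-1) ^ m * Polynomial.coeff
    (∏ r ∈ range m, ((Polynomial.C z - Polynomial.C (q ^ r) * Polynomial.X) *
      (1 - Polynomial.C (q ^ r) * Polynomial.X))) m

theorem map_centralCoeff {R S : Type*} [CommRing R] [CommRing S] (f : R →+* S) (z q : R) (m : ℕ) :
    f (centralCoeff z q m) = centralCoeff (f z) (f q) m := by
  simp only [centralCoeff, map_mul, map_pow, map_neg, map_one, ← Polynomial.coeff_map,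
    Polynomial.map_prod, Polynomial.map_mul, Polynomial.map_sub, Polynomial.map_C,
    Polynomial.map_X, Polynomial.map_one, Polynomial.map_pow]

theorem Svert_eq_centralCoeff {p : ℕ} (hodd : Odd p) (s : ℕ) :
    Svert p s = centralCoeff Zvar Qvar ((p ^ s - 1) / 2) := by
  have h : p ^ s - 1 = (p ^ s - 1) / 2 + (p ^ s - 1) / 2 := by
    obtain ⟨k, hk⟩ := hodd.pow (n := s)
    omega
  rw [Svert, centralCoeff]
  congr 1
  conv_lhs => rw [h]
  have h2 : ((p ^ s - 1) / 2 + (p ^ s - 1) / 2) / 2 = (p ^ s - 1) / 2 := by omega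
  rw [h2, Polynomial.coeff_X_pow_mul]

theorem Finset.prod_range_mul_add_of_periodic {M : Type*} [CommMonoid M] (f : ℕ → M) (N : ℕ)
    (hf : ∀ r, f (r + N) = f r) (a b : ℕ) :
    ∏ r ∈ range (N * a + b), f r = (∏ r ∈ range N, f r) ^ a * ∏ r ∈ range b, f r := by
  induction a with
  | zero => simp
  | succ a ih =>
    rw [show N * (a + 1) + b = N + (N * a + b) by ring, prod_range_add, pow_succ', mul_assoc, ← ih]
    congr 1
    exact prod_congr rfl fun r _ => by rw [add_comm, hf]

theorem Polynomial.coeff_expand_mul_mul_of_natDegree_lt {R : Type*} [CommRing R] {N : ℕ}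
    (A B : Polynomial R) (hB : B.natDegree < N) (a b : ℕ) (hb : b < N) :
    (expand R N A * B).coeff (N * a + b) = A.coeff a * B.coeff b := by
  have hN : 0 < N := by omega
  rw [coeff_mul, sum_eq_single (N * a, b)]
  · simp [mul_comm N a, coeff_expand_mul hN]
  · rintro ⟨i, j⟩ hij hne
    rw [HasAntidiagonal.mem_antidiagonal] at hij
    dsimp only at hij ⊢
    rw [coeff_expand hN]
    split_ifs with hd
    · obtain ⟨c, rfl⟩ := hd
      by_cases hj : j < N
      · exfalso
        have h1 : (N * c + j) % N = j := by rw [Nat.mul_add_mod, Nat.mod_eq_of_lt hj]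
        have h2 : (N * a + b) % N = b := by rw [Nat.mul_add_mod, Nat.mod_eq_of_lt hb]
        have hjb : j = b := by rw [← h1, hij, h2]
        subst hjb
        exact hne (Prod.ext (by dsimp only; omega) rfl)
      · rw [coeff_eq_zero_of_natDegree_lt (by omega : B.natDegree < j), mul_zero]
    · rw [zero_mul]
  · intro h
    exact absurd (HasAntidiagonal.mem_antidiagonal.2 rfl : (N * a, b) ∈ _) h

theorem IsPrimitiveRoot.prod_range_sub_pow_mul {R : Type*} [CommRing R] [IsDomain R] {ζ : R}
    {N : ℕ} (h : IsPrimitiveRoot ζ N) (hN : 0 < N) (x y : R) :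
    ∏ r ∈ range N, (x - ζ ^ r * y) = x ^ N - y ^ N := by
  classical
  rw [h.pow_sub_pow_eq_prod_sub_mul x y hN]
  have himg : Polynomial.nthRootsFinset N (1 : R) = (range N).image (ζ ^ ·) := by
    ext w
    rw [Polynomial.mem_nthRootsFinset hN, mem_image]
    constructor
    · intro hw
      have : NeZero N := ⟨hN.ne'⟩
      obtain ⟨i, hi, rfl⟩ := h.eq_pow_of_pow_eq_one hw
      exact ⟨i, mem_range.2 hi, rfl⟩
    · rintro ⟨i, -, rfl⟩
      rw [← pow_mul, mul_comm, pow_mul, h.pow_eq_one, one_pow]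
  rw [himg, prod_image]
  intro i hi j hj hij
  exact h.pow_inj (by simpa using hi) (by simpa using hj) hij

theorem IsPrimitiveRoot.centralCoeff_mul_add {R : Type*} [CommRing R] [IsDomain R] {ζ : R}
    {N b : ℕ} (h : IsPrimitiveRoot ζ N) (hb : 2 * b + 1 = N) (z : R) (a : ℕ) :
    centralCoeff z ζ (N * a + b) = centralCoeff (z ^ N) 1 a * centralCoeff z ζ b := by
  have hN : 0 < N := by omega
  have hC : IsPrimitiveRoot (Polynomial.C ζ) N := h.map_of_injective Polynomial.C_injective
  have hprod : (∏ r ∈ range N, ((Polynomial.C z - Polynomial.C (ζ ^ r) * Polynomial.X) *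
      (1 - Polynomial.C (ζ ^ r) * Polynomial.X))) ^ a =
      Polynomial.expand R N (∏ r ∈ range a,
        ((Polynomial.C (z ^ N) - Polynomial.C (1 ^ r) * Polynomial.X) *
          (1 - Polynomial.C (1 ^ r) * Polynomial.X))) := by
    rw [prod_mul_distrib]
    simp only [Polynomial.C_pow]
    rw [hC.prod_range_sub_pow_mul hN, hC.prod_range_sub_pow_mul hN]
    simp
  have hdeg : (∏ r ∈ range b, ((Polynomial.C z - Polynomial.C (ζ ^ r) * Polynomial.X) *
      (1 - Polynomial.C (ζ ^ r) * Polynomial.X))).natDegree < N := by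
    refine lt_of_le_of_lt (Polynomial.natDegree_prod_le _ _) ?_
    refine lt_of_le_of_lt (sum_le_card_nsmul _ _ 2 fun r _ => ?_) ?_
    · compute_degree
    · simp; omega
  have hsign : (-1 : R) ^ (N * a + b) = (-1) ^ a * (-1) ^ b := by
    rw [pow_add, pow_mul, Odd.neg_one_pow ⟨b, hb.symm⟩]
  rw [centralCoeff, prod_range_mul_add_of_periodic _ N _ a b, hprod,
    Polynomial.coeff_expand_mul_mul_of_natDegree_lt _ _ hdeg a b (by omega), hsign,
    centralCoeff, centralCoeff]
  · ring
  · intro r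
    simp only [pow_add, h.pow_eq_one, mul_one]

theorem IsPrimitiveRoot.centralCoeff_half_pow_sub_one {R : Type*} [CommRing R] [IsDomain R]
    {p : ℕ} (hodd : Odd p) {ζ : R} {j : ℕ} (h : IsPrimitiveRoot ζ (p ^ j)) (z : R) (t : ℕ) :
    centralCoeff z ζ ((p ^ (j + t) - 1) / 2) =
      centralCoeff (z ^ p ^ j) 1 ((p ^ t - 1) / 2) * centralCoeff z ζ ((p ^ j - 1) / 2) := by
  obtain ⟨b, hb⟩ := hodd.pow (n := j)
  obtain ⟨a, ha⟩ := hodd.pow (n := t)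
  have hm : (p ^ (j + t) - 1) / 2 = p ^ j * a + b := by
    have : p ^ (j + t) = 2 * (p ^ j * a + b) + 1 := by rw [pow_add, ha, mul_add, hb]; ring
    omega
  rw [hm, show (p ^ t - 1) / 2 = a by omega, show (p ^ j - 1) / 2 = b by omega]
  exact h.centralCoeff_mul_add hb.symm z a

theorem Polynomial.geom_sum_X_dvd_of_eval₂_eq_zero {A B : Type*} [CommRing A] [CommRing B]
    [IsDomain A] [IsDomain B] {i : A →+* B} (hi : Function.Injective i) {n : ℕ} (hn : 0 < n)
    {ω : B} (hω : IsPrimitiveRoot ω n) (f : Polynomial A)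
    (hf : ∀ ζ : B, ζ ^ n = 1 → ζ ≠ 1 → f.eval₂ i ζ = 0) :
    (∑ k ∈ range n, (X : Polynomial A) ^ k) ∣ f := by
  have hX : (X - 1 : Polynomial A) ≠ 0 := by simpa using X_sub_C_ne_zero (1 : A)
  rw [← mul_dvd_mul_iff_left hX, mul_geom_sum]
  have hmonic : (X ^ n - 1 : Polynomial A).Monic := by
    simpa using monic_X_pow_sub_C (1 : A) hn.ne'
  rw [← map_dvd_map i hi hmonic]
  by_cases h0 : ((X - 1) * f).map i = 0
  · rw [h0]; exact dvd_zero _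
  have hXn : (X ^ n - 1 : Polynomial A).map i = X ^ n - 1 := by simp
  rw [hXn, X_pow_sub_one_eq_prod hn hω, Finset.prod, Multiset.prod_X_sub_C_dvd_iff_le_roots h0,
    Multiset.le_iff_subset (nthRootsFinset n (1 : B)).nodup]
  intro ζ hζ
  have hζ' : ζ ^ n = 1 := (mem_nthRootsFinset hn _).1 hζ
  rw [mem_roots h0, IsRoot, eval_map, eval₂_mul]
  by_cases h1 : ζ = 1
  · simp [h1]
  · rw [hf ζ hζ' h1, mul_zero]

theorem map_Svert_mul_sub_eq_zero {R : Type*} [CommRing R] [IsDomain R] {p : ℕ} (hp : p.Prime)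
    (hodd : Odd p) {s : ℕ} (f : Zq →+* R) (hq : f Qvar ^ p ^ s = 1) (hq1 : f Qvar ≠ 1) :
    f (Svert p (s + 1) * frobZq p (Svert p (s - 1)) - Svert p s * frobZq p (Svert p s)) = 0 := by
  obtain ⟨j, hj, hord⟩ := (Nat.dvd_prime_pow hp).1 (orderOf_dvd_of_pow_eq_one hq)
  have hζ : IsPrimitiveRoot (f Qvar) (p ^ j) := hord ▸ IsPrimitiveRoot.orderOf (f Qvar)
  have hj0 : j ≠ 0 := by
    rintro rfl
    exact hq1 (orderOf_eq_one_iff.1 (by simpa using hord))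
  obtain ⟨j, rfl⟩ := Nat.exists_eq_succ_of_ne_zero hj0
  obtain ⟨t, rfl⟩ := Nat.exists_eq_add_of_le hj
  have hζp : IsPrimitiveRoot (f Qvar ^ p) (p ^ j) :=
    hζ.pow (pow_pos hp.pos _) (by rw [Nat.succ_eq_add_one, pow_succ'])
  have hZ : f (frobZq p Zvar) = f Zvar ^ p := by simp [frobZq, Zvar]
  have hQ : f (frobZq p Qvar) = f Qvar ^ p := by simp [frobZq, Qvar]
  simp only [Svert_eq_centralCoeff hodd, map_sub, map_mul, map_centralCoeff, hZ, hQ]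
  rw [show j.succ + t + 1 = j.succ + (t + 1) by ring, show j.succ + t - 1 = j + t by omega,
    hζ.centralCoeff_half_pow_sub_one hodd, hζ.centralCoeff_half_pow_sub_one hodd,
    show j.succ + t = j + (t + 1) by omega,
    hζp.centralCoeff_half_pow_sub_one hodd, hζp.centralCoeff_half_pow_sub_one hodd,
    ← pow_mul, Nat.succ_eq_add_one, ← pow_succ']
  ring

/-- **q-deformed Dwork congruence for `T*ℙ¹`**: for every `s ≥ 1`, `[p^s]_q` divides
`S_{s+1}(z,q)·S_{s-1}(z^p,q^p) - S_s(z,q)·S_s(z^p,q^p)` in `ℤ[z,q]`. -/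
theorem q_dwork_congruence_P1 (p : ℕ) (hp : p.Prime) (hodd : Odd p)
    (s : ℕ) (hs : 1 ≤ s) :
    (∑ i ∈ range (p ^ s), Qvar ^ i) ∣
      Svert p (s + 1) * frobZq p (Svert p (s - 1)) -
        Svert p s * frobZq p (Svert p s) := by
  let φ : Zq →+* Polynomial (Polynomial ℤ) :=
    MvPolynomial.eval₂Hom (Int.castRingHom _)
      (fun b => bif b then Polynomial.X else Polynomial.C Polynomial.X)
  let ψ : Polynomial (Polynomial ℤ) →+* Zq :=
    Polynomial.eval₂RingHom (Polynomial.eval₂RingHom (Int.castRingHom _) Zvar) Qvar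
  have hψφ : ψ.comp φ = RingHom.id Zq := by
    refine MvPolynomial.ringHom_ext (fun n => by simp) fun b => ?_
    cases b <;> simp [φ, ψ, Zvar, Qvar]
  have hback : ∀ x, ψ (φ x) = x := fun x => RingHom.congr_fun hψφ x
  have hφQ : φ Qvar = Polynomial.X := by simp [φ, Qvar]
  let ι : Polynomial ℤ →+* Polynomial ℂ := Polynomial.mapRingHom (Int.castRingHom ℂ)
  have hι : Function.Injective ι := Polynomial.map_injective _ Int.cast_injective
  have hpos : 0 < p ^ s := pow_pos hp.pos s
  have hω : IsPrimitiveRoot (Polynomial.C (Complex.exp (2 * Real.pi * Complex.I / (p ^ s : ℕ))))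
      (p ^ s) :=
    (Complex.isPrimitiveRoot_exp _ hpos.ne').map_of_injective Polynomial.C_injective
  have key := Polynomial.geom_sum_X_dvd_of_eval₂_eq_zero hι hpos hω
    (φ (Svert p (s + 1) * frobZq p (Svert p (s - 1)) - Svert p s * frobZq p (Svert p s)))
    fun ζ hζ hζ1 => by
      have hev : ((Polynomial.eval₂RingHom ι ζ).comp φ) Qvar = ζ := by
        rw [RingHom.comp_apply, hφQ]
        simp
      exact map_Svert_mul_sub_eq_zero hp hodd ((Polynomial.eval₂RingHom ι ζ).comp φ)
        (by rw [hev, hζ]) (by rwa [hev])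
  have hgeom : φ (∑ i ∈ range (p ^ s), Qvar ^ i) = ∑ i ∈ range (p ^ s), Polynomial.X ^ i := by
    rw [map_sum]
    exact sum_congr rfl fun i _ => by rw [map_pow, hφQ]
  rw [← hgeom] at key
  simpa only [hback] using map_dvd ψ key
end
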